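/- Let ℓ be a positive integer and c ∈ ℂ with c ≠ 0. Then the set {(x_1,…,x_ℓ) ∈ ℂ^ℓ : x_1⋯x_ℓ = c and x_i ≠ x_j for all i ≠ j} is path-connected. -/

import Mathlib

/-- Every point of the hypersurface is the exponential of a point of the hyperplane. -/
lemma exists_log_tuple (ℓ : ℕ) (hℓ : 0 < ℓ) (c : ℂ) (hc : c ≠ 0) (x : Fin ℓ → ℂ)
    (hx : ∏ i, x i = c) :
    ∃ z : Fin ℓ → ℂ, ∑ i, z i = Complex.log c ∧ ∀ i, Complex.exp (z i) = x i := by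
  have hne : ∀ i, x i ≠ 0 := fun i h =>
    hc (hx ▸ Finset.prod_eq_zero (Finset.mem_univ i) h)
  have h1 : Complex.exp (∑ i, Complex.log (x i)) = c := by
    rw [Complex.exp_sum, ← hx]
    exact Finset.prod_congr rfl fun i _ => Complex.exp_log (hne i)
  have h2 : Complex.exp (Complex.log c - ∑ i, Complex.log (x i)) = 1 := by
    rw [Complex.exp_sub, h1, Complex.exp_log hc, div_self hc]
  refine ⟨fun i => Complex.log (x i) +
    if i = ⟨0, hℓ⟩ then Complex.log c - ∑ i, Complex.log (x i) else 0, ?_, ?_⟩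
  · rw [Finset.sum_add_distrib, Finset.sum_ite_eq' Finset.univ]
    simp
  · intro i
    rw [Complex.exp_add, Complex.exp_log (hne i)]
    split_ifs
    · rw [h2, mul_one]
    · simp

/-- Remark 5.3: the complement of the big diagonal in the hypersurface
`{x ∈ ℂ^ℓ : x_1 ⋯ x_ℓ = c}` (for `c ≠ 0`) is path-connected. -/
theorem stmt13 (ℓ : ℕ) (hℓ : 0 < ℓ) (c : ℂ) (hc : c ≠ 0) :
    IsPathConnected {x : Fin ℓ → ℂ | ∏ i, x i = c ∧ Function.Injective x} := by
  have hℓ' : (ℓ : ℂ) ≠ 0 := by exact_mod_cast hℓ.ne'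
  rw [isPathConnected_iff]
  constructor
  · refine ⟨fun i => Complex.exp ((Complex.log c - ∑ j : Fin ℓ, ((j : ℕ) : ℂ)) / ℓ + ((i : ℕ) : ℂ)),
      ?_, ?_⟩
    · rw [← Complex.exp_sum, Finset.sum_add_distrib]
      simp only [Finset.sum_const, Finset.card_univ, Fintype.card_fin, nsmul_eq_mul]
      rw [mul_div_cancel₀ _ hℓ', sub_add_cancel, Complex.exp_log hc]
    · intro i j hij
      obtain ⟨n, hn⟩ := Complex.exp_eq_exp_iff_exists_int.1 hij
      rw [add_assoc] at hn
      have := congrArg Complex.re (add_left_cancel hn)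
      simp at this
      exact Fin.ext this
  · rintro x ⟨hx, hxi⟩ y ⟨hy, hyi⟩
    obtain ⟨a, ha, hax⟩ := exists_log_tuple ℓ hℓ c hc x hx
    obtain ⟨b, hb, hby⟩ := exists_log_tuple ℓ hℓ c hc y hy
    let f : ℂ → Fin ℓ → ℂ := fun t i => Complex.exp (a i + t * (b i - a i))
    have hf : Continuous f := by fun_prop
    have f0 : f 0 = x := by ext i; simp [f, hax]
    have f1 : f 1 = y := by ext i; simp [f, hby]
    let B : Set ℂ := {t | ¬ Function.Injective (f t)}
    have hB : B.Countable := by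
      have hsub : B ⊆ ⋃ (i : Fin ℓ) (j : Fin ℓ) (n : ℤ),
          {((a j - a i) + n * (2 * Real.pi * Complex.I)) / ((b i - a i) - (b j - a j))} := by
        intro t ht
        simp only [B, Set.mem_setOf_eq, Function.Injective] at ht
        push Not at ht
        obtain ⟨i, j, hij, hne⟩ := ht
        obtain ⟨n, hn⟩ := Complex.exp_eq_exp_iff_exists_int.1 hij
        simp only [Set.mem_iUnion, Set.mem_singleton_iff]
        refine ⟨i, j, n, ?_⟩
        have hd : (b i - a i) - (b j - a j) ≠ 0 := by
          intro h
          apply hne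
          apply hxi
          rw [← hax, ← hax]
          refine Complex.exp_eq_exp_iff_exists_int.2 ⟨n, ?_⟩
          linear_combination hn - t * h
        rw [eq_div_iff hd]
        linear_combination hn
      refine Set.Countable.mono hsub ?_
      exact Set.countable_iUnion fun i => Set.countable_iUnion fun j =>
        Set.countable_iUnion fun n => Set.countable_singleton _
    have hpc : IsPathConnected Bᶜ :=
      hB.isPathConnected_compl_of_one_lt_rank (by simp [Complex.rank_real_complex])
    have h0 : (0 : ℂ) ∈ Bᶜ := by simpa [B, f0] using hxi
    have h1 : (1 : ℂ) ∈ Bᶜ := by simpa [B, f1] using hyi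
    have hj := ((hpc.joinedIn 0 h0 1 h1).map_continuousOn (f := f) hf.continuousOn)
    rw [f0, f1] at hj
    refine hj.mono ?_
    rintro _ ⟨t, ht, rfl⟩
    refine ⟨?_, by simpa [B] using ht⟩
    simp only [f]
    rw [← Complex.exp_sum, Finset.sum_add_distrib, ← Finset.mul_sum, Finset.sum_sub_distrib, ha, hb,
      sub_self, mul_zero, add_zero, Complex.exp_log hc]
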